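/- Fix 1 ≤ k ≤ n. There is a unique index φ, defined on nonempty coalitions T ⊆ N with |T| ≤ k, satisfying joint linearity, joint null, joint efficiency of order k, joint anonymity, and joint symmetry; it is given by φ_T(v) = Σ_{S⊆N∖T} q_{|S|}[v(S∪T)−v(S)] where (q_0,…,q_{n−1}) is the unique solution of q_0 = 1/(Σ_{i=1}^k C(n,i)) and q_r = (Σ_{s=max(r−k,0)}^{r−1} C(r,s)q_s)/(Σ_{s=1}^{min(k,n−r)} C(n−r,s)) for 1 ≤ r ≤ n−1. -/

import Mathlib

open Finset

/-- The axioms: joint linearity, joint null, joint efficiency of order `k`,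
joint anonymity, and joint symmetry, for an index `φ` on games over `Fin n`. -/
def JointAxioms (n k : ℕ) (φ : (Finset (Fin n) → ℝ) → Finset (Fin n) → ℝ) : Prop :=
  -- joint linearity
  (∀ v w : Finset (Fin n) → ℝ, v ∅ = 0 → w ∅ = 0 →
    ∀ T : Finset (Fin n), φ (v + w) T = φ v T + φ w T) ∧
  (∀ (c : ℝ) (v : Finset (Fin n) → ℝ), v ∅ = 0 →
    ∀ T : Finset (Fin n), φ (c • v) T = c * φ v T) ∧
  -- joint null
  (∀ v : Finset (Fin n) → ℝ, v ∅ = 0 → ∀ T : Finset (Fin n), T.Nonempty →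
    (∀ S ⊆ Tᶜ, v (S ∪ T) = v S) → φ v T = 0) ∧
  -- joint efficiency of order k
  (∀ v : Finset (Fin n) → ℝ, v ∅ = 0 →
    ∑ T ∈ univ.filter (fun T : Finset (Fin n) => T.Nonempty ∧ T.card ≤ k),
      φ v T = v univ) ∧
  -- joint anonymity
  (∀ σ : Equiv.Perm (Fin n), ∀ v : Finset (Fin n) → ℝ, v ∅ = 0 →
    ∀ T : Finset (Fin n), T.Nonempty →
      φ v T = φ (fun R => v (R.image σ.symm)) (T.image σ)) ∧
  -- joint symmetry
  (∀ v : Finset (Fin n) → ℝ, v ∅ = 0 →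
    ∀ T T' : Finset (Fin n), T.Nonempty → T'.Nonempty →
    (∀ S ⊆ (T ∪ T')ᶜ, v (S ∪ T) = v (S ∪ T')) →
    (∀ S ⊆ Tᶜ, (S ∩ T').Nonempty → v (S ∪ T) = v S) →
    (∀ S ⊆ T'ᶜ, (S ∩ T).Nonempty → v (S ∪ T') = v S) →
    φ v T = φ v T')

/-- The joint marginal-contribution formula with weights `f`. -/
noncomputable def jform {n : ℕ} (f : ℕ → ℝ) (v : Finset (Fin n) → ℝ) (T : Finset (Fin n)) : ℝ :=
  ∑ S ∈ Tᶜ.powerset, f S.card * (v (S ∪ T) - v S)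

/-- Indicator game. -/
def dirac {n : ℕ} (R : Finset (Fin n)) : Finset (Fin n) → ℝ := fun X => if X = R then 1 else 0

lemma down_sum {n : ℕ} (k : ℕ) (f : ℕ → ℝ) (R : Finset (Fin n)) :
    ∑ S ∈ R.powerset.filter (fun S => S.card < R.card ∧ R.card ≤ S.card + k), f S.card
      = ∑ s ∈ Finset.Ico (R.card - k) R.card, (R.card.choose s : ℝ) * f s := by
  rw [Finset.sum_filter]
  rw [Finset.sum_powerset_apply_card
    (fun s => if s < R.card ∧ R.card ≤ s + k then f s else 0)]
  simp only [nsmul_eq_mul, mul_ite, mul_zero]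
  rw [← Finset.sum_filter]
  apply Finset.sum_congr _ (fun _ _ => rfl)
  ext s
  simp only [mem_filter, mem_range, mem_Ico]
  omega

lemma up_sum {n : ℕ} (k : ℕ) (R : Finset (Fin n)) :
    ∑ T ∈ Rᶜ.powerset.filter (fun T => T.Nonempty ∧ T.card ≤ k), (1 : ℝ)
      = ∑ s ∈ Finset.Icc 1 (min k (n - R.card)), ((n - R.card).choose s : ℝ) := by
  have h : Rᶜ.powerset.filter (fun T => T.Nonempty ∧ T.card ≤ k)
      = Rᶜ.powerset.filter (fun T => 1 ≤ T.card ∧ T.card ≤ k) := by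
    ext T
    simp [Nat.one_le_iff_ne_zero, Finset.nonempty_iff_ne_empty]
  rw [h, Finset.sum_filter]
  rw [Finset.sum_powerset_apply_card (fun s => if 1 ≤ s ∧ s ≤ k then (1 : ℝ) else 0)]
  simp only [nsmul_eq_mul, mul_ite, mul_zero, mul_one, card_compl, Fintype.card_fin]
  rw [← Finset.sum_filter]
  apply Finset.sum_congr _ (fun _ _ => rfl)
  ext s
  simp only [mem_filter, mem_range, mem_Icc]
  omega

lemma total_sum {n : ℕ} (k : ℕ) (f : ℕ → ℝ) (v : Finset (Fin n) → ℝ) :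
    ∑ T ∈ univ.filter (fun T : Finset (Fin n) => T.Nonempty ∧ T.card ≤ k), jform f v T
      = ∑ R : Finset (Fin n), v R *
        ((∑ s ∈ Finset.Ico (R.card - k) R.card, (R.card.choose s : ℝ) * f s)
        - (∑ s ∈ Finset.Icc 1 (min k (n - R.card)), ((n - R.card).choose s : ℝ)) * f R.card) := by
  simp only [jform, mul_sub, Finset.sum_sub_distrib]
  congr 1
  · simp only [← down_sum, Finset.mul_sum]
    rw [Finset.sum_sigma', Finset.sum_sigma']
    refine Finset.sum_bij' (fun x _ => ⟨x.2 ∪ x.1, x.2⟩) (fun x _ => ⟨x.1 \ x.2, x.2⟩) ?_ ?_ ?_ ?_ ?_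
    · rintro ⟨T, S⟩ h
      simp only [mem_sigma, mem_filter, mem_univ, true_and, mem_powerset] at h ⊢
      obtain ⟨⟨h1, h2⟩, h3⟩ := h
      have hd : Disjoint S T := by
        rwa [← Finset.subset_compl_iff_disjoint_right]
      rw [Finset.card_union_of_disjoint hd]
      have := h1.card_pos
      exact ⟨subset_union_left, by omega, by omega⟩
    · rintro ⟨R, S⟩ h
      simp only [mem_sigma, mem_filter, mem_univ, true_and, mem_powerset] at h ⊢
      obtain ⟨h1, h2, h3⟩ := h
      have hc := Finset.card_sdiff_of_subset h1
      refine ⟨⟨?_, by omega⟩, ?_⟩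
      · rw [← Finset.card_pos]; omega
      · intro x hx; simp [hx]
    · rintro ⟨T, S⟩ h
      simp only [mem_sigma, mem_filter, mem_univ, true_and, mem_powerset] at h ⊢
      obtain ⟨⟨h1, h2⟩, h3⟩ := h
      have hd : Disjoint S T := by
        rwa [← Finset.subset_compl_iff_disjoint_right]
      simp only [Finset.union_sdiff_cancel_left hd]
    · rintro ⟨R, S⟩ h
      simp only [mem_sigma, mem_filter, mem_univ, true_and, mem_powerset] at h ⊢
      simp only [Finset.union_sdiff_of_subset h.1]
    · rintro ⟨T, S⟩ h
      simp only [mul_comm]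
  · simp only [← up_sum, Finset.mul_sum, Finset.sum_mul]
    rw [Finset.sum_comm' (t' := univ)
      (s' := fun S => Sᶜ.powerset.filter (fun T => T.Nonempty ∧ T.card ≤ k))]
    · refine Finset.sum_congr rfl fun R _ => Finset.sum_congr rfl fun T _ => by ring
    · intro T S
      simp only [mem_filter, mem_univ, true_and, mem_powerset, and_true]
      rw [Finset.subset_compl_comm]
      tauto

lemma jform_dirac_sup {n : ℕ} (f : ℕ → ℝ) {R T : Finset (Fin n)} (hT : T.Nonempty) (h : T ⊆ R) :
    jform f (dirac R) T = f (R \ T).card := by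
  unfold jform
  rw [Finset.sum_eq_single (R \ T)]
  · have h2 : R \ T ≠ R := by
      intro h'
      obtain ⟨x, hx⟩ := hT
      have := h hx
      rw [← h'] at this
      simp [hx] at this
    simp [dirac, Finset.sdiff_union_of_subset h, h2]
  · intro S hS hne
    rw [mem_powerset, Finset.subset_compl_iff_disjoint_right] at hS
    have h1 : S ∪ T ≠ R := by
      rintro rfl
      exact hne (Finset.union_sdiff_cancel_right hS).symm
    have h2 : S ≠ R := by
      rintro rfl
      obtain ⟨x, hx⟩ := hT
      exact Finset.disjoint_left.1 hS (h hx) hx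
    simp [dirac, h1, h2]
  · intro h'
    exact absurd (by rw [mem_powerset]; intro x hx; simp at hx ⊢; exact hx.2) h'

lemma jform_dirac_disj {n : ℕ} (f : ℕ → ℝ) {R T : Finset (Fin n)} (hT : T.Nonempty)
    (h : Disjoint R T) :
    jform f (dirac R) T = - f R.card := by
  have hne : ∀ S, S ∪ T ≠ R := by
    rintro S rfl
    obtain ⟨x, hx⟩ := hT
    exact Finset.disjoint_left.1 h (mem_union_right _ hx) hx
  unfold jform
  rw [Finset.sum_eq_single R]
  · simp [dirac, hne]
  · intro S hS hn
    simp [dirac, hne, hn]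
  · intro h'
    exact absurd (by rwa [mem_powerset, Finset.subset_compl_iff_disjoint_right]) h'

lemma exists_perm_aux {n : ℕ} {S S' : Finset (Fin n)} {t t' : Fin n} (ht : t ∉ S) (ht' : t' ∉ S')
    (hc : S.card = S'.card) : ∃ σ : Equiv.Perm (Fin n), σ t = t' ∧ S.image σ = S' := by
  classical
  let e := Finset.equivOfCardEq hc
  let σ : Equiv.Perm (Fin n) := Equiv.extendSubtype e
  have hσ : ∀ x, σ x ∈ S' ↔ x ∈ S := by
    intro x
    constructor
    · intro h
      by_contra hx
      exact Equiv.extendSubtype_not_mem e x hx h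
    · intro hx
      exact Equiv.extendSubtype_mem e x hx
  refine ⟨σ.trans (Equiv.swap (σ t) t'), by simp, ?_⟩
  apply Finset.eq_of_subset_of_card_le
  · intro y hy
    rw [mem_image] at hy
    obtain ⟨x, hx, rfl⟩ := hy
    have h1 : σ x ∈ S' := (hσ x).2 hx
    have h2 : σ x ≠ σ t := fun h => ht ((hσ t).1 (h ▸ h1))
    have h3 : σ x ≠ t' := fun h => ht' (h ▸ h1)
    simp only [Equiv.trans_apply]
    rwa [Equiv.swap_apply_of_ne_of_ne h2 h3]
  · rw [Finset.card_image_of_injective _ (Equiv.injective _), hc]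

lemma jform_satisfies (n k : ℕ) (hn : 1 ≤ n) (hk1 : 1 ≤ k) (hkn : k ≤ n)
    (q : ℕ → ℝ)
    (hq0 : q 0 = 1 / ∑ i ∈ Finset.Icc 1 k, (n.choose i : ℝ))
    (hqr : ∀ r, 1 ≤ r → r ≤ n - 1 →
      q r = (∑ s ∈ Finset.Ico (r - k) r, (r.choose s : ℝ) * q s) /
            (∑ s ∈ Finset.Icc 1 (min k (n - r)), ((n - r).choose s : ℝ)))
    (hpos : ∀ r, r < n →
      0 < ∑ s ∈ Finset.Icc 1 (min k (n - r)), ((n - r).choose s : ℝ)) :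
    JointAxioms n k (jform q) := by
  refine ⟨?_, ?_, ?_, ?_, ?_, ?_⟩
  · intro v w _ _ T
    simp only [jform, ← Finset.sum_add_distrib, Pi.add_apply]
    exact Finset.sum_congr rfl fun S _ => by ring
  · intro c v _ T
    simp only [jform, Finset.mul_sum, Pi.smul_apply, smul_eq_mul]
    exact Finset.sum_congr rfl fun S _ => by ring
  · intro v _ T _ h
    refine Finset.sum_eq_zero fun S hS => ?_
    rw [h S (mem_powerset.1 hS)]; ring
  · intro v hv
    have hcoef : ∀ R : Finset (Fin n), R ≠ ∅ → R ≠ univ →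
        ((∑ s ∈ Finset.Ico (R.card - k) R.card, (R.card.choose s : ℝ) * q s)
        - (∑ s ∈ Finset.Icc 1 (min k (n - R.card)), ((n - R.card).choose s : ℝ)) * q R.card)
          = 0 := by
      intro R h1 h2
      have h3 : 1 ≤ R.card := Finset.card_pos.2 (Finset.nonempty_iff_ne_empty.2 h1)
      have h4 : R.card < n := by
        obtain ⟨x, hx⟩ : ∃ x, x ∉ R := by
          by_contra! h
          exact h2 (by ext x; simp [h x])
        have := Finset.card_lt_univ_of_notMem hx
        simpa using this
      have h5 := hpos _ h4
      have h6 := hqr R.card h3 (by omega)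
      rw [eq_div_iff h5.ne'] at h6
      linarith
    have hne : (∅ : Finset (Fin n)) ≠ univ := by
      intro h
      have := congrArg Finset.card h
      simp at this
      omega
    have key : ∀ w : Finset (Fin n) → ℝ, 
      ∑ T ∈ univ.filter (fun T : Finset (Fin n) => T.Nonempty ∧ T.card ≤ k), jform q w T
      = w univ * (∑ s ∈ Finset.Ico (n - k) n, (n.choose s : ℝ) * q s) - w ∅ := by
      intro w
      rw [total_sum]
      have h0 := hpos 0 (by omega)
      rw [← Finset.sum_subset (Finset.subset_univ {∅, univ})]
      · rw [Finset.sum_pair hne]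
        simp only [Finset.card_empty, Finset.card_univ, Fintype.card_fin]
        simp only [Nat.sub_zero, min_eq_left hkn] at h0
        simp [hq0, min_eq_left hkn, h0.ne']
        ring
      · intro R _ hR
        simp only [mem_insert, mem_singleton, not_or] at hR
        rw [hcoef R hR.1 hR.2, mul_zero]
    have h1 := key (fun _ => 1)
    have h2 : ∑ T ∈ univ.filter (fun T : Finset (Fin n) => T.Nonempty ∧ T.card ≤ k),
        jform q (fun _ => 1) T = 0 := by
      simp [jform]
    rw [h2] at h1
    rw [key v, hv]
    have h3 : (∑ s ∈ Finset.Ico (n - k) n, (n.choose s : ℝ) * q s) = 1 := by linarith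
    rw [h3]; ring
  · intro σ v _ T _
    unfold jform
    refine Finset.sum_bij' (fun S _ => S.image σ) (fun S _ => S.image σ.symm) ?_ ?_ ?_ ?_ ?_
    · intro S hS
      rw [mem_powerset] at hS ⊢
      intro x hx
      rw [mem_image] at hx
      obtain ⟨y, hy, rfl⟩ := hx
      have := hS hy
      simpa using this
    · intro S hS
      rw [mem_powerset] at hS ⊢
      intro x hx
      rw [mem_image] at hx
      obtain ⟨y, hy, rfl⟩ := hx
      have := hS hy
      simp only [mem_compl, mem_image, not_exists, not_and] at this ⊢
      intro h
      exact this _ h (by simp)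
    · intro S _
      simp [Finset.image_image]
    · intro S _
      simp [Finset.image_image]
    · intro S _
      rw [← Finset.image_union]
      simp [Finset.image_image, Finset.card_image_of_injective _ σ.injective]
  · intro v _ T T' hT hT' h1 h2 h3
    have aux : ∀ A B : Finset (Fin n), (∀ S ⊆ Aᶜ, (S ∩ B).Nonempty → v (S ∪ A) = v S) →
        jform q v A = ∑ S ∈ (A ∪ B)ᶜ.powerset, q S.card * (v (S ∪ A) - v S) := by
      intro A B h
      unfold jform
      symm
      apply Finset.sum_subset
      · apply Finset.powerset_mono.2
        apply Finset.compl_subset_compl.2 subset_union_left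
      · intro S hS hS'
        rw [mem_powerset] at hS hS'
        rw [h S hS, sub_self, mul_zero]
        by_contra h4
        apply hS'
        rw [Finset.not_nonempty_iff_eq_empty, ← Finset.disjoint_iff_inter_eq_empty] at h4
        rw [Finset.subset_compl_iff_disjoint_right] at hS ⊢
        exact Finset.disjoint_union_right.2 ⟨hS, h4⟩
    rw [aux T T' h2, aux T' T h3, Finset.union_comm T' T]
    refine Finset.sum_congr rfl fun S hS => ?_
    rw [h1 S (mem_powerset.1 hS)]

lemma dirac_empty {n : ℕ} {R : Finset (Fin n)} (h : R.Nonempty) : dirac R ∅ = 0 := by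
  simp [dirac, h.ne_empty.symm]

/-- Two linear functionals agreeing on indicator games agree. -/
lemma lin_ext {n : ℕ} (ψ : (Finset (Fin n) → ℝ) → ℝ)
    (hadd : ∀ v w : Finset (Fin n) → ℝ, v ∅ = 0 → w ∅ = 0 → ψ (v + w) = ψ v + ψ w)
    (hsmul : ∀ (c : ℝ) (v : Finset (Fin n) → ℝ), v ∅ = 0 → ψ (c • v) = c * ψ v)
    (h : ∀ R : Finset (Fin n), R.Nonempty → ψ (dirac R) = 0)
    (v : Finset (Fin n) → ℝ) (hv : v ∅ = 0) : ψ v = 0 := by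
  have hz : ψ 0 = 0 := by
    have := hsmul 0 0 rfl
    simpa using this
  have key : ∀ A : Finset (Finset (Fin n)), (∅ ∉ A) →
      (∑ R ∈ A, v R • dirac R) ∅ = 0 ∧ ψ (∑ R ∈ A, v R • dirac R) = 0 := by
    intro A
    induction A using Finset.induction_on with
    | empty => intro _; simp [hz]
    | insert R A hR ih =>
      intro hA
      simp only [mem_insert, not_or] at hA
      have hRn : R.Nonempty := Finset.nonempty_iff_ne_empty.2 (Ne.symm hA.1)
      obtain ⟨i1, i2⟩ := ih hA.2
      rw [Finset.sum_insert hR]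
      have h0 : (v R • dirac R) ∅ = 0 := by simp [dirac_empty hRn]
      refine ⟨by rw [Pi.add_apply, h0, i1, add_zero], ?_⟩
      rw [hadd _ _ h0 i1, i2, hsmul _ _ (dirac_empty hRn), h R hRn]
      ring
  have h2 := (key (univ.erase ∅) (by simp)).2
  have h3 : ∑ R ∈ univ.erase ∅, v R • dirac R = v := by
    funext X
    rw [Finset.sum_apply]
    simp only [Pi.smul_apply, dirac, smul_eq_mul, mul_ite, mul_one, mul_zero]
    rw [Finset.sum_ite_eq]
    by_cases hX : X = ∅
    · simp [hX, hv]
    · simp [hX]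
  rwa [h3] at h2

lemma exists_weights (n k : ℕ) (φ : (Finset (Fin n) → ℝ) → Finset (Fin n) → ℝ)
    (hφ : JointAxioms n k φ) :
    ∃ f : ℕ → ℝ, ∀ v : Finset (Fin n) → ℝ, v ∅ = 0 → ∀ T : Finset (Fin n), T.Nonempty →
      φ v T = jform f v T := by
  classical
  obtain ⟨hadd, hsmul, hnull, -, hanon, hsym⟩ := hφ
  -- anonymity for singletons
  have han : ∀ (S S' : Finset (Fin n)) (t t' : Fin n), t ∉ S → t' ∉ S' → S.card = S'.card →
      φ (dirac (S ∪ {t})) {t} = φ (dirac (S' ∪ {t'})) {t'} := by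
    intro S S' t t' ht ht' hc
    obtain ⟨σ, h1, h2⟩ := exists_perm_aux ht ht' hc
    rw [hanon σ (dirac (S ∪ {t})) (dirac_empty (by simp)) {t} (by simp)]
    congr 1
    · funext R
      have : R.image σ.symm = S ∪ {t} ↔ R = S' ∪ {t'} := by
        rw [← h1, ← h2, ← Finset.image_singleton, ← Finset.image_union]
        constructor
        · intro h; rw [← h]; simp [Finset.image_image]
        · rintro rfl; simp [Finset.image_image]
      simp only [dirac, this]
    · simp [h1]
  -- symmetry
  have hsy : ∀ (S T : Finset (Fin n)) (t : Fin n), t ∈ T → Disjoint S T →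
      φ (dirac (S ∪ T)) T = φ (dirac (S ∪ {t})) {t} := by
    intro S T t ht hd
    by_cases hT1 : T = {t}
    · rw [hT1]
    have htS : t ∉ S := fun h => Finset.disjoint_left.1 hd h ht
    obtain ⟨u, huT, hut⟩ : ∃ u ∈ T, u ≠ t := by
      by_contra! h
      exact hT1 (Finset.eq_singleton_iff_unique_mem.2 ⟨ht, h⟩)
    have huS : u ∉ S := fun h => Finset.disjoint_left.1 hd h huT
    set a := dirac (S ∪ {t}) with ha
    set b := dirac (S ∪ T) with hb
    set c := dirac (S ∪ T.erase t) with hc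
    have hTn : T.Nonempty := ⟨t, ht⟩
    have a0 : a ∅ = 0 := dirac_empty (by simp)
    have b0 : b ∅ = 0 := dirac_empty ⟨t, by simp [ht]⟩
    have c0 : c ∅ = 0 := dirac_empty ⟨u, by simp [hut, huT]⟩
    have bc0 : (b + c) ∅ = 0 := by simp [b0, c0]
    have abc0 : (a + (b + c)) ∅ = 0 := by simp [b0, c0, a0]
    -- values
    have m1 : ∀ X : Finset (Fin n), t ∉ X → a X = 0 := by
      intro X hX
      simp only [ha, dirac, ite_eq_right_iff]
      rintro rfl; simp at hX
    have m2 : ∀ X : Finset (Fin n), t ∉ X → b X = 0 := by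
      intro X hX
      simp only [hb, dirac, ite_eq_right_iff]
      rintro rfl; simp [ht] at hX
    have m3 : ∀ X : Finset (Fin n), t ∈ X → c X = 0 := by
      intro X hX
      simp only [hc, dirac, ite_eq_right_iff]
      rintro rfl; simp [htS] at hX
    have m4 : ∀ X : Finset (Fin n), t ∉ X → b (X ∪ {t}) = c X := by
      intro X hX
      have : X ∪ {t} = S ∪ T ↔ X = S ∪ T.erase t := by
        constructor
        · intro h
          ext x
          have := Finset.ext_iff.1 h x
          by_cases hx : x = t
          · subst hx; simp [hX, htS]
          · simpa [hx] using this
        · rintro rfl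
          ext x
          by_cases hx : x = t
          · subst hx; simp [ht]
          · simp [hx]
      simp only [hb, hc, dirac, this]
    have m5 : ∀ X : Finset (Fin n), u ∈ X → a X = 0 := by
      intro X hX
      simp only [ha, dirac, ite_eq_right_iff]
      rintro rfl; simp [huS, hut] at hX
    have m6 : ∀ X : Finset (Fin n), u ∉ X → c X = 0 := by
      intro X hX
      simp only [hc, dirac, ite_eq_right_iff]
      rintro rfl; simp [hut, huT] at hX
    have m7 : ∀ X : Finset (Fin n), X ⊆ Tᶜ → a (X ∪ {t}) = b (X ∪ T) := by
      intro X hX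
      rw [Finset.subset_compl_iff_disjoint_right] at hX
      have htX : t ∉ X := fun h => Finset.disjoint_left.1 hX h ht
      have e1 : X ∪ {t} = S ∪ {t} ↔ X = S := by
        constructor
        · intro h
          ext x
          have := Finset.ext_iff.1 h x
          by_cases hx : x = t
          · subst hx; simp [htX, htS]
          · simpa [hx] using this
        · rintro rfl; rfl
      have e2 : X ∪ T = S ∪ T ↔ X = S := by
        constructor
        · intro h
          rw [← Finset.union_sdiff_cancel_right hX, h, Finset.union_sdiff_cancel_right hd]
        · rintro rfl; rfl
      simp only [ha, hb, dirac, e1, e2]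
    have m8 : ∀ X : Finset (Fin n), ¬ Disjoint X T → t ∉ X → a (X ∪ {t}) = 0 := by
      intro X hX htX
      simp only [ha, dirac, ite_eq_right_iff]
      intro h
      exfalso
      apply hX
      rw [Finset.disjoint_left]
      intro x hx hxT
      have := Finset.ext_iff.1 h x
      by_cases hxt : x = t
      · exact htX (hxt ▸ hx)
      · simp [hxt, hx] at this
        exact Finset.disjoint_left.1 hd this hxT
    have hs := hsym (a + (b + c)) abc0 {t} T (by simp) hTn (by
      intro X hX
      have hXT : X ⊆ Tᶜ := hX.trans (Finset.compl_subset_compl.2 subset_union_right)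
      have hX' := hXT
      rw [Finset.subset_compl_iff_disjoint_right] at hX'
      have htX : t ∉ X := fun h => Finset.disjoint_left.1 hX' h ht
      have huX : u ∉ X := fun h => Finset.disjoint_left.1 hX' h huT
      simp only [Pi.add_apply]
      rw [m7 X hXT, m4 X htX, m6 X huX, m3 _ (by simp), m5 (X ∪ T) (by simp [huT]),
        m3 _ (by simp [ht])]
      ring) (by
      intro X hX hne
      have htX : t ∉ X := fun h => by simpa using hX h
      simp only [Pi.add_apply]
      rw [m8 X (by rw [Finset.disjoint_iff_inter_eq_empty]; exact hne.ne_empty) htX, m4 X htX,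
        m3 (X ∪ {t}) (by simp), m1 X htX, m2 X htX]
      ring) (by
      intro X hX hne
      exfalso
      obtain ⟨x, hx⟩ := hne
      simp only [mem_inter, mem_singleton] at hx
      obtain ⟨hx, rfl⟩ := hx
      simpa [ht] using hX hx)
    have n1 : φ (b + c) {t} = 0 := by
      apply hnull _ bc0 _ (by simp)
      intro X hX
      have htX : t ∉ X := fun h => by simpa using hX h
      simp only [Pi.add_apply]
      rw [m4 X htX, m3 (X ∪ {t}) (by simp), m2 X htX]; ring
    have n2 : φ (a + c) T = 0 := by
      apply hnull _ (by simp [a0, c0]) _ hTn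
      intro X hX
      rw [Finset.subset_compl_iff_disjoint_right] at hX
      have htX : t ∉ X := fun h => Finset.disjoint_left.1 hX h ht
      have huX : u ∉ X := fun h => Finset.disjoint_left.1 hX h huT
      simp only [Pi.add_apply]
      rw [m5 _ (by simp [huT]), m3 _ (by simp [ht]), m1 X htX, m6 X huX]
    rw [hadd a (b + c) a0 bc0, n1, add_left_comm, hadd b (a + c) b0 (by simp [a0, c0]), n2] at hs
    linarith
  -- weights
  let f : ℕ → ℝ := fun s =>
    if h : ∃ p : Finset (Fin n) × Fin n, p.2 ∉ p.1 ∧ p.1.card = s then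
      φ (dirac (h.choose.1 ∪ {h.choose.2})) {h.choose.2} else 0
  have hf : ∀ (S T : Finset (Fin n)), T.Nonempty → Disjoint S T →
      φ (dirac (S ∪ T)) T = f S.card := by
    intro S T hT hd
    obtain ⟨t, ht⟩ := hT
    have htS : t ∉ S := fun h => Finset.disjoint_left.1 hd h ht
    have h : ∃ p : Finset (Fin n) × Fin n, p.2 ∉ p.1 ∧ p.1.card = S.card := ⟨(S, t), htS, rfl⟩
    rw [hsy S T t ht hd]
    simp only [f]
    rw [dif_pos h]
    exact han _ _ _ _ htS h.choose_spec.1 h.choose_spec.2.symm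
  refine ⟨f, fun v hv T hT => ?_⟩
  have hd : ∀ R : Finset (Fin n), R.Nonempty → φ (dirac R) T = jform f (dirac R) T := by
    intro R hR
    by_cases h1 : T ⊆ R
    · rw [jform_dirac_sup f hT h1, ← hf (R \ T) T hT Finset.sdiff_disjoint,
        Finset.sdiff_union_of_subset h1]
    · by_cases h2 : Disjoint R T
      · rw [jform_dirac_disj f hT h2, ← hf R T hT h2]
        have h3 : φ (dirac R + dirac (R ∪ T)) T = 0 := by
          have hRT : (R ∪ T).Nonempty := hR.mono subset_union_left
          apply hnull _ (by simp [dirac_empty hR, dirac_empty hRT]) T hT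
          intro X hX
          rw [Finset.subset_compl_iff_disjoint_right] at hX
          have e1 : X ∪ T ≠ R := by
            rintro rfl; exact h1 subset_union_right
          have e2 : X ≠ R ∪ T := by
            rintro rfl
            obtain ⟨x, hx⟩ := hT
            exact Finset.disjoint_left.1 hX (mem_union_right _ hx) hx
          have e3 : X ∪ T = R ∪ T ↔ X = R := by
            constructor
            · intro h
              rw [← Finset.union_sdiff_cancel_right hX, h, Finset.union_sdiff_cancel_right h2]
            · rintro rfl; rfl
          simp [dirac, e1, e2, e3]
        rw [hadd _ _ (dirac_empty hR) (dirac_empty (hR.mono subset_union_left))] at h3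
        linarith
      · have hz : ∀ X ⊆ Tᶜ, dirac R (X ∪ T) = dirac R X := by
          intro X hX
          rw [Finset.subset_compl_iff_disjoint_right] at hX
          have e1 : X ∪ T ≠ R := by
            rintro rfl; exact h1 subset_union_right
          have e2 : X ≠ R := by
            rintro rfl; exact h2 hX
          simp [dirac, e1, e2]
        rw [hnull _ (dirac_empty hR) T hT hz]
        symm
        refine Finset.sum_eq_zero fun S hS => ?_
        rw [hz S (mem_powerset.1 hS)]; ring
  have := lin_ext (fun w => φ w T - jform f w T) (by
    intro v w h1 h2
    simp only [hadd v w h1 h2, jform, Pi.add_apply]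
    rw [sub_add_sub_comm, ← Finset.sum_add_distrib]
    congr 1
    exact Finset.sum_congr rfl fun S _ => by ring) (by
    intro c v h1
    simp only [hsmul c v h1, jform, Pi.smul_apply, smul_eq_mul, mul_sub, Finset.mul_sum]
    congr 1
    exact Finset.sum_congr rfl fun S _ => by ring) (by
    intro R hR
    simp only [hd R hR, sub_self]) v hv
  exact sub_eq_zero.1 this

/-- Theorem (main): for each order of explanation `k`, there is a unique (up to
the `k`-th order of explanation) index satisfying the joint axioms, namely the
joint Shapley value `φ^J_T(v) = ∑_{S ⊆ N\T} q_{|S|} (v(S∪T) - v S)` where `q`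
solves the recursive system. -/
theorem stmt16 (n k : ℕ) (hn : 1 ≤ n) (hk1 : 1 ≤ k) (hkn : k ≤ n)
    (q : ℕ → ℝ)
    (hq0 : q 0 = 1 / ∑ i ∈ Finset.Icc 1 k, (n.choose i : ℝ))
    (hqr : ∀ r, 1 ≤ r → r ≤ n - 1 →
      q r = (∑ s ∈ Finset.Ico (r - k) r, (r.choose s : ℝ) * q s) /
            (∑ s ∈ Finset.Icc 1 (min k (n - r)), ((n - r).choose s : ℝ))) :
    JointAxioms n k
      (fun v T => ∑ S ∈ Tᶜ.powerset, q S.card * (v (S ∪ T) - v S)) ∧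
    ∀ φ : (Finset (Fin n) → ℝ) → Finset (Fin n) → ℝ, JointAxioms n k φ →
      ∀ v : Finset (Fin n) → ℝ, v ∅ = 0 →
        ∀ T : Finset (Fin n), T.Nonempty → T.card ≤ k →
          φ v T = ∑ S ∈ Tᶜ.powerset, q S.card * (v (S ∪ T) - v S) := by
  have hpos : ∀ r, r < n →
      0 < ∑ s ∈ Finset.Icc 1 (min k (n - r)), ((n - r).choose s : ℝ) := by
    intro r hr
    apply Finset.sum_pos
    · intro s hs
      rw [mem_Icc] at hs
      exact_mod_cast Nat.choose_pos (by omega)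
    · exact ⟨1, by rw [mem_Icc]; omega⟩
  refine ⟨jform_satisfies n k hn hk1 hkn q hq0 hqr hpos, ?_⟩
  intro φ hφ v hv T hT hTk
  obtain ⟨f, hf⟩ := exists_weights n k φ hφ
  have heff : ∀ w : Finset (Fin n) → ℝ, w ∅ = 0 →
      ∑ T ∈ univ.filter (fun T : Finset (Fin n) => T.Nonempty ∧ T.card ≤ k), jform f w T
        = w univ := by
    intro w hw
    rw [← hφ.2.2.2.1 w hw]
    refine Finset.sum_congr rfl fun T hT => ?_
    rw [mem_filter] at hT
    rw [hf w hw T hT.2.1]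
  have hfq : ∀ r, r < n → f r = q r := by
    intro r
    induction r using Nat.strong_induction_on with
    | _ r ih =>
      intro hr
      rcases Nat.eq_zero_or_pos r with rfl | hr0
      · have h1 := heff (fun R => if R = ∅ then 0 else 1) (by simp)
        have h2 : ∀ T ∈ univ.filter (fun T : Finset (Fin n) => T.Nonempty ∧ T.card ≤ k),
            jform f (fun R => if R = ∅ then 0 else 1) T = 1 * f 0 := by
          intro T hT
          rw [mem_filter] at hT
          have hTn := hT.2.1.ne_empty
          unfold jform
          rw [Finset.sum_eq_single ∅]
          · simp [hTn]
          · intro S _ hS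
            simp [hS]
          · simp
        have hne : (univ : Finset (Fin n)) ≠ ∅ := by
          intro h
          have := congrArg Finset.card h
          simp at this
          omega
        have h3 := up_sum (n := n) k ∅
        have hp := hpos 0 hr
        simp only [Finset.card_empty, Nat.sub_zero, min_eq_left hkn, Finset.compl_empty,
          Finset.powerset_univ] at h3 hp
        rw [Finset.sum_congr rfl h2, ← Finset.sum_mul, h3, if_neg hne] at h1
        rw [hq0, eq_div_iff hp.ne']
        linarith
      · obtain ⟨R, -, hR⟩ := Finset.exists_subset_card_eq (s := (univ : Finset (Fin n))) (n := r)
          (by simpa using hr.le)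
        have hRn : R.Nonempty := by rw [← Finset.card_pos]; omega
        have h1 := heff (dirac R) (dirac_empty hRn)
        have hRu : (univ : Finset (Fin n)) ≠ R := by
          rintro rfl
          simp at hR
          omega
        rw [total_sum, Finset.sum_eq_single R] at h1
        · simp only [dirac, if_true, hRu, if_false, hR, one_mul] at h1
          rw [hqr r hr0 (by omega), eq_div_iff (hpos r hr).ne']
          have h2 : ∑ s ∈ Finset.Ico (r - k) r, (r.choose s : ℝ) * f s
              = ∑ s ∈ Finset.Ico (r - k) r, (r.choose s : ℝ) * q s := by
            refine Finset.sum_congr rfl fun s hs => ?_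
            rw [mem_Ico] at hs
            rw [ih s hs.2 (by omega)]
          linarith
        · intro X _ hX
          simp [dirac, hX]
        · simp
  rw [hf v hv T hT]
  refine Finset.sum_congr rfl fun S hS => ?_
  rw [hfq]
  rw [mem_powerset] at hS
  have h1 := Finset.card_le_card hS
  rw [Finset.card_compl, Fintype.card_fin] at h1
  have := hT.card_pos
  omega
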